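/- arXiv:1507.04330 — 2 statements merged into one kernel-verified Lean document; each statement's English description precedes it below -/
import Mathlib

section
/- Let P ⊆ V be a set of vertices with v* ∈ P, and let π and σ be two linear orders on V such that π|_P = σ|_P and π|_{V∖P} = σ|_{V∖P}. If S'(π) = P, then P ⊆ S'(σ). -/
open scoped Classical

noncomputable section

variable {V : Type*}

/-- The MIS invariant: `v ∈ M` iff no earlier neighbor of `v` is in `M`. -/
def misInv (G : SimpleGraph V) (π : V → ℕ) (M : Set V) : Prop :=
  ∀ v, v ∈ M ↔ ∀ u, G.Adj u v → π u < π v → u ∉ M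

/-- Membership in the greedy MIS of `G` under the order `π`. -/
def greedy (G : SimpleGraph V) (π : V → ℕ) (v : V) : Prop :=
  ∀ u, G.Adj u v → ∀ _hlt : π u < π v, ¬ greedy G π u
termination_by π v

/-- The greedy MIS of `G` under the order `π`. -/
def greedySet (G : SimpleGraph V) (π : V → ℕ) : Set V := {v | greedy G π v}

/-- The MIS invariant holds at vertex `v` for states `M`. -/
def invAt (G : SimpleGraph V) (M : Set V) (π : V → ℕ) (v : V) : Prop :=
  v ∈ M ↔ ∀ u, G.Adj u v → π u < π v → u ∉ M

/-- `I_π(u)`: neighbors of `u` preceding `u` in `π`. -/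
def Iset (G : SimpleGraph V) (π : V → ℕ) (u : V) : Set V :=
  {w | G.Adj w u ∧ π w < π u}

/-- The layers `S_i` of the influenced set. -/
def Slayer (H : SimpleGraph V) (M : Set V) (π : V → ℕ) (v0 : V) : ℕ → Set V
  | 0 => {v0}
  | i + 1 =>
      {u | u ∈ M ∧ ∃ w ∈ Slayer H M π v0 i, w ∈ Iset H π u} ∪
      {u | u ∉ M ∧ ∀ w ∈ Iset H π u, w ∈ M → ∃ j, ∃ _hj : j ≤ i, w ∈ Slayer H M π v0 j}
decreasing_by all_goals omega

/-- The union of all layers. -/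
def Sunion (H : SimpleGraph V) (M : Set V) (π : V → ℕ) (v0 : V) : Set V :=
  ⋃ i, Slayer H M π v0 i

/-- The influenced set: empty when the invariant is not `broken` at `v0`. -/
def Sinfl (H : SimpleGraph V) (M : Set V) (π : V → ℕ) (v0 : V) (broken : Prop) : Set V :=
  if broken then Sunion H M π v0 else ∅

/-- The order obtained from `π` by moving `v0` to be first. -/
def pushFirst (π : V → ℕ) (v0 : V) : V → ℕ :=
  fun v => if v = v0 then 0 else π v + 1

/-- The ℕ-valued order attached to a uniformly random bijection `V ≃ Fin |V|`. -/
def toOrd [Fintype V] (π : V ≃ Fin (Fintype.card V)) : V → ℕ := fun v => (π v : ℕ)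

/-- `π` and `σ` induce the same relative order on `A`. -/
def sameOrderOn (π σ : V → ℕ) (A : Set V) : Prop :=
  ∀ x ∈ A, ∀ y ∈ A, (π x < π y ↔ σ x < σ y)

/-- Data describing a topology change: the old and new graphs, the graph `HS` in which
the influenced set `S` is computed, the graph `HSp` in which `S'` is computed,
the distinguished vertices `vs = v*` and `vss = v**`, the states `M` (as a function of
the order), and the condition `broken` under which the invariant fails at `v*`. -/
structure ChangeData (V : Type*) where
  Gold : SimpleGraph V
  Gnew : SimpleGraph V
  HS : SimpleGraph V
  HSp : SimpleGraph V
  vs : V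
  vss : V
  M : (V → ℕ) → Set V
  broken : (V → ℕ) → Prop

variable {V : Type*}

/-- Edge insertion between `v*` and `v**`. -/
def IsEdgeIns (c : ChangeData V) : Prop :=
  c.vs ≠ c.vss ∧ ¬ c.Gold.Adj c.vs c.vss ∧
  (∀ x y, c.Gnew.Adj x y ↔ c.Gold.Adj x y ∨ (x = c.vs ∧ y = c.vss) ∨ (x = c.vss ∧ y = c.vs)) ∧
  c.HS = c.Gnew ∧ c.HSp = c.Gold ∧
  (∀ π, c.M π = greedySet c.Gold π) ∧
  (∀ π, c.broken π ↔ ¬ invAt c.Gnew (c.M π) π c.vs)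

/-- Edge deletion between `v*` and `v**`. -/
def IsEdgeDel (c : ChangeData V) : Prop :=
  c.vs ≠ c.vss ∧ c.Gold.Adj c.vs c.vss ∧
  (∀ x y, c.Gnew.Adj x y ↔ c.Gold.Adj x y ∧ ¬ ((x = c.vs ∧ y = c.vss) ∨ (x = c.vss ∧ y = c.vs))) ∧
  c.HS = c.Gnew ∧ c.HSp = c.Gnew ∧
  (∀ π, c.M π = greedySet c.Gold π) ∧
  (∀ π, c.broken π ↔ ¬ invAt c.Gnew (c.M π) π c.vs)

/-- Deletion of the node `v*` (modeled on a common vertex type: `v*` is isolated in `Gnew`). -/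
def IsNodeDel (c : ChangeData V) : Prop :=
  c.vss = c.vs ∧
  (∀ x y, c.Gnew.Adj x y ↔ c.Gold.Adj x y ∧ x ≠ c.vs ∧ y ≠ c.vs) ∧
  c.HS = c.Gold ∧ c.HSp = c.Gold ∧
  (∀ π, c.M π = greedySet c.Gold π) ∧
  (∀ π, c.broken π ↔ c.vs ∈ c.M π)

/-- Insertion of the node `v*` (modeled on a common vertex type: `v*` is isolated in `Gold`). -/
def IsNodeIns (c : ChangeData V) : Prop :=
  c.vss = c.vs ∧
  (∀ x y, c.Gold.Adj x y ↔ c.Gnew.Adj x y ∧ x ≠ c.vs ∧ y ≠ c.vs) ∧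
  c.HS = c.Gnew ∧ c.HSp = c.Gnew ∧
  (∀ π, c.M π = greedySet c.Gold π \ {c.vs}) ∧
  (∀ π, c.broken π ↔ ¬ ∃ u, c.Gnew.Adj u c.vs ∧ π u < π c.vs ∧ u ∈ c.M π)

/-- One of the four topology changes. -/
def IsTopoChange (c : ChangeData V) : Prop :=
  IsEdgeIns c ∨ IsEdgeDel c ∨ IsNodeDel c ∨ IsNodeIns c

/-- The influenced set `S(G_old, G_new, π)`. -/
def Sset (c : ChangeData V) (π : V → ℕ) : Set V :=
  Sinfl c.HS (c.M π) π c.vs (c.broken π)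

/-- The set `S'(G_old, G_new, τ, v*)`: same recursion, from `v*` always, in the graph `HSp`,
with `v*` moved to be first in the order, and states given by `M(G_old, τ)`. -/
def Spset (c : ChangeData V) (τ : V → ℕ) : Set V :=
  ⋃ i, Slayer c.HSp (c.M τ) (pushFirst τ c.vs) c.vs i


theorem mem_greedySet_iff {V : Type*} (G : SimpleGraph V) (π : V → ℕ) (v : V) :
    v ∈ greedySet G π ↔ ∀ u, G.Adj u v → π u < π v → u ∉ greedySet G π := by
  change greedy G π v ↔ _
  rw [greedy]
  rfl

theorem eq_greedySet_of_misInv {V : Type*} {G : SimpleGraph V} {π : V → ℕ} {M : Set V}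
    (hM : misInv G π M) : M = greedySet G π := by
  ext v
  induction hn : π v using Nat.strong_induction_on generalizing v with
  | _ n ih =>
    subst hn
    rw [hM v, mem_greedySet_iff]
    exact forall_congr' fun u => forall_congr' fun _ => forall_congr' fun hlt =>
      not_congr (ih _ hlt u rfl)

theorem greedySet_independent {V : Type*} {G : SimpleGraph V} {π : V → ℕ}
    (hπ : Function.Injective π) {u v : V} (huv : G.Adj u v)
    (hu : u ∈ greedySet G π) : v ∉ greedySet G π := by
  intro hv
  rcases lt_trichotomy (π u) (π v) with h | h | h
  · exact (mem_greedySet_iff G π v).1 hv u huv h hu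
  · exact huv.ne (hπ h)
  · exact (mem_greedySet_iff G π u).1 hu v huv.symm h hv

section Sunion

variable {V : Type*} {H : SimpleGraph V} {M : Set V} {p : V → ℕ} {v₀ u : V}

theorem mem_Sunion_self : v₀ ∈ Sunion H M p v₀ :=
  Set.mem_iUnion.2 ⟨0, by rw [Slayer]; rfl⟩

theorem mem_Sunion_of_mem {w : V} (hu : u ∈ M) (hw : w ∈ Sunion H M p v₀)
    (hwu : w ∈ Iset H p u) : u ∈ Sunion H M p v₀ := by
  obtain ⟨i, hi⟩ := Set.mem_iUnion.1 hw
  refine Set.mem_iUnion.2 ⟨i + 1, ?_⟩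
  rw [Slayer]
  exact Or.inl ⟨hu, w, hi, hwu⟩

theorem mem_Sunion_of_notMem [Fintype V] (hu : u ∉ M)
    (h : ∀ w ∈ Iset H p u, w ∈ M → w ∈ Sunion H M p v₀) : u ∈ Sunion H M p v₀ := by
  have hj : ∀ w, ∃ j, w ∈ Iset H p u → w ∈ M → w ∈ Slayer H M p v₀ j := by
    intro w
    by_cases hw : w ∈ Iset H p u ∧ w ∈ M
    · obtain ⟨j, hj⟩ := Set.mem_iUnion.1 (h w hw.1 hw.2)
      exact ⟨j, fun _ _ => hj⟩
    · exact ⟨0, fun h₁ h₂ => absurd ⟨h₁, h₂⟩ hw⟩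
  choose j hj using hj
  refine Set.mem_iUnion.2 ⟨Finset.univ.sup j + 1, ?_⟩
  rw [Slayer]
  exact Or.inr ⟨hu, fun w h₁ h₂ => ⟨j w, Finset.le_sup (Finset.mem_univ w), hj w h₁ h₂⟩⟩

theorem Sunion_cases (hu : u ∈ Sunion H M p v₀) :
    u = v₀ ∨ (u ∈ M ∧ ∃ w ∈ Iset H p u, w ∈ Sunion H M p v₀) ∨
      (u ∉ M ∧ ∀ w ∈ Iset H p u, w ∈ M → w ∈ Sunion H M p v₀) := by
  obtain ⟨i, hi⟩ := Set.mem_iUnion.1 hu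
  cases i with
  | zero => rw [Slayer] at hi; exact Or.inl hi
  | succ i =>
    rw [Slayer] at hi
    rcases hi with ⟨h, w, hw, hwu⟩ | ⟨h, hw⟩
    · exact Or.inr (Or.inl ⟨h, w, hwu, Set.mem_iUnion.2 ⟨i, hw⟩⟩)
    · refine Or.inr (Or.inr ⟨h, fun w h₁ h₂ => ?_⟩)
      obtain ⟨j, _, hj⟩ := hw w h₁ h₂
      exact Set.mem_iUnion.2 ⟨j, hj⟩

end Sunion

theorem pushFirst_lt_iff {V : Type*} {π : V → ℕ} {v₀ u v : V} (hu : u ≠ v₀) :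
    pushFirst π v₀ u < pushFirst π v₀ v ↔ v ≠ v₀ ∧ π u < π v := by
  by_cases hv : v = v₀ <;> simp [pushFirst, hu, hv]

theorem pushFirst_lt_of_lt {V : Type*} {π : V → ℕ} {v₀ u v : V} (hv : v ≠ v₀)
    (h : π u < π v) : pushFirst π v₀ u < pushFirst π v₀ v := by
  by_cases hu : u = v₀ <;> simp [pushFirst, hu, hv, h]

theorem sameOrderOn_pushFirst {V : Type*} {π σ : V → ℕ} {A : Set V} (h : sameOrderOn π σ A)
    (v₀ : V) : sameOrderOn (pushFirst π v₀) (pushFirst σ v₀) A := by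
  intro x hx y hy
  have := h x hx y hy
  by_cases h₁ : x = v₀ <;> by_cases h₂ : y = v₀ <;> simp [pushFirst, h₁, h₂, this]

theorem IsTopoChange.adj_iff {V : Type*} {c : ChangeData V} (hc : IsTopoChange c) {x y : V}
    (hx : x ≠ c.vs) (hy : y ≠ c.vs) : c.HSp.Adj x y ↔ c.Gold.Adj x y := by
  rcases hc with h | h | h | h
  · obtain ⟨-, -, -, -, h, -⟩ := h
    rw [h]
  · obtain ⟨-, -, h', -, h, -⟩ := h
    rw [h, h']
    tauto
  · obtain ⟨-, -, -, h, -⟩ := h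
    rw [h]
  · obtain ⟨-, h', -, h, -⟩ := h
    rw [h, h']
    tauto

theorem IsTopoChange.states {V : Type*} {c : ChangeData V} (hc : IsTopoChange c) :
    (∀ τ, c.M τ = greedySet c.Gold τ) ∨
      ((∀ τ, c.M τ = greedySet c.Gold τ \ {c.vs}) ∧ ∀ x, ¬ c.Gold.Adj c.vs x) := by
  rcases hc with h | h | h | h
  · exact Or.inl h.2.2.2.2.2.1
  · exact Or.inl h.2.2.2.2.2.1
  · exact Or.inl h.2.2.2.2.1
  · refine Or.inr ⟨h.2.2.2.2.1, fun x hx => ?_⟩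
    exact ((h.2.1 _ _).1 hx).2.1 rfl

theorem IsTopoChange.mem_states_iff {V : Type*} {c : ChangeData V} (hc : IsTopoChange c)
    (τ : V → ℕ) {x : V} (hx : x ≠ c.vs) : x ∈ c.M τ ↔ x ∈ greedySet c.Gold τ := by
  rcases hc.states with h | ⟨h, -⟩ <;> simp [h, hx]

theorem IsTopoChange.notMem_of_adj {V : Type*} {c : ChangeData V} (hc : IsTopoChange c)
    {τ : V → ℕ} (hτ : Function.Injective τ) {x y : V} (hx : x ≠ c.vs) (hy : y ≠ c.vs)
    (hxy : c.HSp.Adj x y) (hxM : x ∈ c.M τ) : y ∉ c.M τ := by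
  rw [hc.mem_states_iff τ hx] at hxM
  rw [hc.mem_states_iff τ hy]
  exact greedySet_independent hτ ((hc.adj_iff hx hy).1 hxy) hxM

section Spset

variable {V : Type*} {c : ChangeData V} {π : V → ℕ} {u w : V}

/-- Vertices of `M` outside `Spset` have no neighbor in `Spset`. -/
theorem IsTopoChange.not_adj_of_mem_Spset (hc : IsTopoChange c)
    (hπ : Function.Injective π) (hu : u ∈ Spset c π) (hw : w ∉ Spset c π)
    (hwM : w ∈ c.M π) : ¬ c.HSp.Adj u w := by
  intro huw
  have hwv : w ≠ c.vs := fun h => hw (h ▸ mem_Sunion_self)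
  by_cases hlt : pushFirst π c.vs u < pushFirst π c.vs w
  · exact hw (mem_Sunion_of_mem hwM hu ⟨huw, hlt⟩)
  have huv : u ≠ c.vs := by
    rintro rfl
    exact hlt (by simp [pushFirst, hwv])
  have hwu : pushFirst π c.vs w < pushFirst π c.vs u := by
    rw [pushFirst_lt_iff huv] at hlt
    rw [pushFirst_lt_iff hwv]
    exact ⟨huv, (hπ.ne huw.ne).lt_or_gt.resolve_left fun h => hlt ⟨hwv, h⟩⟩
  rcases Sunion_cases hu with h | ⟨h, -⟩ | ⟨-, h⟩
  · exact huv h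
  · exact hc.notMem_of_adj hπ hwv huv huw.symm hwM h
  · exact hw (h w ⟨huw.symm, hwu⟩ hwM)

/-- A vertex outside both `M` and `Spset` has an earlier neighbor in `M ∖ Spset`. -/
theorem exists_mem_Iset_of_notMem_Spset [Fintype V] (hw : w ∉ Spset c π) (hwM : w ∉ c.M π) :
    ∃ y ∈ Iset c.HSp (pushFirst π c.vs) w, y ∈ c.M π ∧ y ∉ Spset c π := by
  by_contra! h
  exact hw (mem_Sunion_of_notMem hwM h)

end Spset

/-- If `v* ∈ M(π)`, then a reordering preserving the order within `Spset c π` and within its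
complement does not change the greedy MIS. -/
theorem IsTopoChange.states_eq_of_mem {V : Type*} [Fintype V] {c : ChangeData V}
    (hc : IsTopoChange c) {π σ : V → ℕ} (hπ : Function.Injective π)
    (h1 : sameOrderOn π σ (Spset c π)) (h2 : sameOrderOn π σ (Spset c π)ᶜ)
    (hv : c.vs ∈ c.M π) : c.M σ = c.M π := by
  have hM : ∀ τ, c.M τ = greedySet c.Gold τ := by
    rcases hc.states with h | ⟨h, -⟩
    · exact h
    · simp [h] at hv
  have hvS : c.vs ∈ Spset c π := mem_Sunion_self
  rw [hM σ]
  refine (eq_greedySet_of_misInv fun v => ⟨fun hvM u huv _ hu => ?_, fun h => ?_⟩).symm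
  · rw [hM] at hu hvM
    exact greedySet_independent hπ huv hu hvM
  by_contra hvM
  have hvv : v ≠ c.vs := fun h => hvM (h ▸ hv)
  by_cases hvP : v ∈ Spset c π
  · have hvM' := hvM
    rw [hM, mem_greedySet_iff] at hvM'
    push Not at hvM'
    obtain ⟨w, hwv, hlt, hw⟩ := hvM'
    rw [← hM] at hw
    by_cases hwP : w ∈ Spset c π
    · exact h w hwv ((h1 w hwP v hvP).1 hlt) hw
    · have hwv' : w ≠ c.vs := fun h => hwP (h ▸ hvS)
      exact hc.not_adj_of_mem_Spset hπ hvP hwP hw ((hc.adj_iff hvv hwv').2 hwv.symm)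
  · obtain ⟨y, ⟨hyv, hlt⟩, hyM, hyP⟩ := exists_mem_Iset_of_notMem_Spset hvP hvM
    have hyv' : y ≠ c.vs := fun h => hyP (h ▸ hvS)
    exact h y ((hc.adj_iff hyv' hvv).1 hyv)
      ((h2 y hyP v hvP).1 ((pushFirst_lt_iff hyv').1 hlt).2) hyM

/-- A vertex of `Spset c π` other than `v*` that lies in `M(σ)` has an earlier neighbor in
`Spset c π`. -/
theorem IsTopoChange.exists_mem_Iset_of_mem_Spset {V : Type*} [Fintype V] {c : ChangeData V}
    (hc : IsTopoChange c) {π σ : V → ℕ} (hπ : Function.Injective π)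
    (h1 : sameOrderOn π σ (Spset c π)) (h2 : sameOrderOn π σ (Spset c π)ᶜ)
    {u : V} (hu : u ∈ Spset c π) (huv : u ≠ c.vs) (huσ : u ∈ c.M σ) :
    ∃ w ∈ Iset c.HSp (pushFirst π c.vs) u, w ∈ Spset c π := by
  rcases Sunion_cases hu with h | ⟨-, h⟩ | ⟨hun, -⟩
  · exact absurd h huv
  · exact h
  have hv : c.vs ∉ c.M π := fun hv =>
    hun (hc.states_eq_of_mem hπ h1 h2 hv ▸ huσ)
  have hun' := hun
  rw [hc.mem_states_iff π huv, mem_greedySet_iff] at hun'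
  push Not at hun'
  obtain ⟨w, hwu, hlt, hw⟩ := hun'
  have hwv : w ≠ c.vs := by
    rintro rfl
    rcases hc.states with h | ⟨-, h⟩
    · exact hv (by rwa [h])
    · exact h u hwu
  have hwu' := (hc.adj_iff hwv huv).2 hwu
  refine ⟨w, ⟨hwu', pushFirst_lt_of_lt huv hlt⟩, ?_⟩
  by_contra hwP
  exact hc.not_adj_of_mem_Spset hπ hu hwP ((hc.mem_states_iff π hwv).2 hw) hwu'.symm

/-- If `π` and `σ` agree on `P` and on `V ∖ P` and `S'(π) = P`, then `P ⊆ S'(σ)`. -/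
theorem stmt6 {V : Type*} [Fintype V] (c : ChangeData V) (hc : IsTopoChange c)
    (π σ : V → ℕ) (hπ : Function.Injective π) (hσ : Function.Injective σ)
    (P : Set V) (hvP : c.vs ∈ P)
    (h1 : sameOrderOn π σ P) (h2 : sameOrderOn π σ Pᶜ)
    (hSp : Spset c π = P) :
    P ⊆ Spset c σ := by
  subst hSp
  have k1 := sameOrderOn_pushFirst h1 c.vs
  have k2 := sameOrderOn_pushFirst h2 c.vs
  have key : ∀ n u, pushFirst σ c.vs u = n →
      (u ∈ Spset c π ∨ ¬ (u ∈ c.M π ↔ u ∈ c.M σ)) → u ∈ Spset c σ := by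
    intro n
    induction n using Nat.strong_induction_on with
    | _ n ih =>
    rintro u rfl hu
    by_cases huσ : u ∈ c.M σ
    · by_cases huv : u = c.vs
      · exact huv ▸ mem_Sunion_self
      by_cases huP : u ∈ Spset c π
      · obtain ⟨w, ⟨hwu, hlt⟩, hw⟩ := hc.exists_mem_Iset_of_mem_Spset hπ h1 h2 huP huv huσ
        have hlt' := (k1 w hw u huP).1 hlt
        exact mem_Sunion_of_mem huσ (ih _ hlt' w rfl (Or.inl hw)) ⟨hwu, hlt'⟩
      · have huπ : u ∉ c.M π := by tauto
        obtain ⟨y, ⟨hyu, hlt⟩, hyM, hyP⟩ := exists_mem_Iset_of_notMem_Spset huP huπ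
        have hyv : y ≠ c.vs := fun h => hyP (h ▸ hvP)
        have hlt' := (k2 y hyP u huP).1 hlt
        have hyσ := hc.notMem_of_adj hσ huv hyv hyu.symm huσ
        exact mem_Sunion_of_mem huσ (ih _ hlt' y rfl (Or.inr (by tauto))) ⟨hyu, hlt'⟩
    · refine mem_Sunion_of_notMem huσ fun x ⟨hxu, hlt⟩ hxσ => ih _ hlt x rfl ?_
      by_cases hxP : x ∈ Spset c π
      · exact Or.inl hxP
      suffices hxπ : x ∉ c.M π from Or.inr (by tauto)
      intro hxπ
      by_cases huP : u ∈ Spset c π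
      · exact hc.not_adj_of_mem_Spset hπ huP hxP hxπ hxu.symm
      · have hxv : x ≠ c.vs := fun h => hxP (h ▸ hvP)
        have huv : u ≠ c.vs := fun h => huP (h ▸ hvP)
        exact hc.notMem_of_adj hπ hxv huv hxu hxπ (by tauto)
  exact fun u hu => key _ u rfl (Or.inl hu)

end
end

section
/- For any set of vertices P ⊆ V such that the event {S'(π) = P and π(v**) ≤ π(v*)} has positive probability, the probability, over a uniformly random linear order π, that π(v*) = min{π(u) : u ∈ P}, conditioned on S'(π) = P and π(v**) ≤ π(v*), is at most 1/|P|; moreover, for a node change (where v** = v*) it equals exactly 1/|P|. -/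
open scoped Classical

noncomputable section

variable {V : Type*}

variable {V : Type*}

/-- A three-valued evaluation of the greedy MIS of `H` under `τ` in which `v` is put first and has
unknown state: `F` is the set of vertices certainly in the MIS, `P` the set of vertices of unknown
state, and all the others are certainly out of the MIS. -/
structure IsPartialEval (H : SimpleGraph V) (τ : V → ℕ) (v : V) (F P : Set V) : Prop where
  root_mem : v ∈ P
  disjoint : ∀ u ∈ F, u ∉ P
  mem_in : ∀ u, u ≠ v → (u ∈ F ↔ ∀ w, H.Adj w u → w = v ∨ τ w < τ u → w ∉ F ∧ w ∉ P)
  mem_unknown : ∀ u, u ≠ v → (u ∈ P ↔ (∀ w, H.Adj w u → w = v ∨ τ w < τ u → w ∉ F) ∧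
    ∃ w, H.Adj w u ∧ (w = v ∨ τ w < τ u) ∧ w ∈ P)

theorem IsPartialEval.unique {H : SimpleGraph V} {τ : V → ℕ} {v : V} {F P F' P' : Set V}
    (h : IsPartialEval H τ v F P) (h' : IsPartialEval H τ v F' P') : P = P' := by
  have root : (v ∈ F ↔ v ∈ F') ∧ (v ∈ P ↔ v ∈ P') :=
    ⟨⟨fun hv => absurd h.root_mem (h.disjoint v hv),
      fun hv => absurd h'.root_mem (h'.disjoint v hv)⟩,
      iff_of_true h.root_mem h'.root_mem⟩
  have key : ∀ n u, τ u = n → (u ∈ F ↔ u ∈ F') ∧ (u ∈ P ↔ u ∈ P') := by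
    intro n
    induction n using Nat.strong_induction_on with
    | _ n ih =>
      intro u hu
      by_cases huv : u = v
      · exact huv ▸ root
      have early : ∀ w, w = v ∨ τ w < τ u → (w ∈ F ↔ w ∈ F') ∧ (w ∈ P ↔ w ∈ P') := by
        rintro w (rfl | hw)
        · exact root
        · exact ih (τ w) (hu ▸ hw) w rfl
      rw [h.mem_in u huv, h'.mem_in u huv, h.mem_unknown u huv, h'.mem_unknown u huv]
      grind
  ext u
  exact (key _ u rfl).2

theorem IsPartialEval.not_adj {H : SimpleGraph V} {τ : V → ℕ} (hτ : Function.Injective τ) {v : V}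
    {F P : Set V} (h : IsPartialEval H τ v F P) {u w : V} (hu : u ∈ F) (hw : w ∈ P) :
    ¬ H.Adj w u := by
  intro hwu
  have huv : u ≠ v := fun e => h.disjoint u hu (e ▸ h.root_mem)
  have hin := (h.mem_in u huv).1 hu w hwu
  by_cases hwv : w = v
  · exact (hin (Or.inl hwv)).2 hw
  rcases lt_trichotomy (τ w) (τ u) with hlt | heq | hlt
  · exact (hin (Or.inr hlt)).2 hw
  · exact hwu.ne (hτ heq)
  · exact ((h.mem_unknown w hwv).1 hw).1 u hwu.symm (Or.inr hlt) hu

/-- A partial evaluation does not depend on how the unknown vertices are interleaved with the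
other ones. -/
theorem IsPartialEval.reorder {H : SimpleGraph V} {τ σ : V → ℕ} (hτ : Function.Injective τ)
    {v : V} {F P : Set V} (h : IsPartialEval H τ v F P) (hout : sameOrderOn τ σ Pᶜ)
    (hin : sameOrderOn τ σ (P \ {v})) : IsPartialEval H σ v F P := by
  have na := @IsPartialEval.not_adj V H τ hτ v F P h
  have out : ∀ x y, x ∉ P → y ∉ P → (τ x < τ y ↔ σ x < σ y) := fun x y hx hy => hout x hx y hy
  have ins : ∀ x y, x ∈ P → y ∈ P → x ≠ v → y ≠ v → (τ x < τ y ↔ σ x < σ y) :=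
    fun x y hx hy hxv hyv => hin x ⟨hx, hxv⟩ y ⟨hy, hyv⟩
  have root := h.root_mem
  have disj := h.disjoint
  refine ⟨root, disj, fun u huv => ?_, fun u huv => ?_⟩
  · have h1 := h.mem_in u huv
    have h2 := h.mem_unknown u huv
    constructor
    · intro hu w hw hlt
      have hwP : w ∉ P := fun hwP => na hu hwP hw
      have hwv : w ≠ v := fun e => hwP (e ▸ root)
      exact h1.1 hu w hw (Or.inr ((out w u hwP (disj u hu)).2 (hlt.resolve_left hwv)))
    · intro hw
      by_cases huP : u ∈ P
      · obtain ⟨w, hwu, hlt, hwP⟩ := (h2.1 huP).2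
        by_cases hwv : w = v
        · exact absurd hwP (hw w hwu (Or.inl hwv)).2
        · exact absurd hwP (hw w hwu (Or.inr
            ((ins w u hwP huP hwv huv).1 (hlt.resolve_left hwv)))).2
      · by_contra huF
        have : ∃ w, H.Adj w u ∧ (w = v ∨ τ w < τ u) ∧ w ∈ F := by grind
        obtain ⟨w, hwu, hlt, hwF⟩ := this
        have hwv : w ≠ v := fun e => disj w hwF (e ▸ root)
        exact (hw w hwu (Or.inr ((out w u (disj w hwF) huP).1 (hlt.resolve_left hwv)))).1 hwF
  · have h1 := h.mem_in u huv
    have h2 := h.mem_unknown u huv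
    constructor
    · intro huP
      refine ⟨fun w hwu _ hwF => na hwF huP hwu.symm, ?_⟩
      obtain ⟨w, hwu, hlt, hwP⟩ := (h2.1 huP).2
      refine ⟨w, hwu, ?_, hwP⟩
      by_cases hwv : w = v
      · exact Or.inl hwv
      · exact Or.inr ((ins w u hwP huP hwv huv).1 (hlt.resolve_left hwv))
    · rintro ⟨hF, w, hwu, -, hwP⟩
      by_contra huP
      have huF : u ∉ F := fun huF => na huF hwP hwu
      have : ∃ w, H.Adj w u ∧ (w = v ∨ τ w < τ u) ∧ w ∈ F := by grind
      obtain ⟨x, hxu, hlt, hxF⟩ := this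
      have hxv : x ≠ v := fun e => disj x hxF (e ▸ root)
      exact hF x hxu (Or.inr ((out x u (disj x hxF) huP).1 (hlt.resolve_left hxv))) hxF

theorem mem_Iset_pushFirst {H : SimpleGraph V} {τ : V → ℕ} {v u w : V} (hu : u ≠ v) :
    w ∈ Iset H (pushFirst τ v) u ↔ H.Adj w u ∧ (w = v ∨ τ w < τ u) := by
  by_cases hw : w = v <;> simp [Iset, pushFirst, hu, hw]

theorem mem_Sunion_iff [Finite V] {H : SimpleGraph V} {M : Set V} {π : V → ℕ} {v u : V}
    (hu : u ≠ v) :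
    u ∈ Sunion H M π v ↔ (u ∈ M ∧ ∃ w ∈ Iset H π u, w ∈ Sunion H M π v) ∨
      (u ∉ M ∧ ∀ w ∈ Iset H π u, w ∈ M → w ∈ Sunion H M π v) := by
  simp only [Sunion, Set.mem_iUnion]
  constructor
  · rintro ⟨_ | i, hi⟩
    · rw [Slayer] at hi
      exact absurd hi hu
    · rw [Slayer] at hi
      rcases hi with ⟨hM, w, hw, hwI⟩ | ⟨hM, hall⟩
      · exact Or.inl ⟨hM, w, hwI, i, hw⟩
      · refine Or.inr ⟨hM, fun w hw hwM => ?_⟩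
        obtain ⟨j, -, hj⟩ := hall w hw hwM
        exact ⟨j, hj⟩
  · rintro (⟨hM, w, hwI, i, hw⟩ | ⟨hM, hall⟩)
    · refine ⟨i + 1, ?_⟩
      rw [Slayer]
      exact Or.inl ⟨hM, w, hw, hwI⟩
    · have : ∀ w, ∃ j, w ∈ Iset H π u → w ∈ M → w ∈ Slayer H M π v j := by
        intro w
        by_cases hw : w ∈ Iset H π u ∧ w ∈ M
        · obtain ⟨j, hj⟩ := hall w hw.1 hw.2
          exact ⟨j, fun _ _ => hj⟩
        · exact ⟨0, fun h1 h2 => absurd ⟨h1, h2⟩ hw⟩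
      choose f hf using this
      obtain ⟨n, hn⟩ := (Set.finite_range f).bddAbove
      refine ⟨n + 1, ?_⟩
      rw [Slayer]
      exact Or.inr ⟨hM, fun w hw hwM => ⟨f w, hn ⟨w, rfl⟩, hf w hw hwM⟩⟩

theorem isPartialEval_Sunion [Finite V] {H : SimpleGraph V} {M : Set V} {τ : V → ℕ} {v : V}
    (hind : ∀ u, u ≠ v → u ∈ M → ∀ w, w ≠ v → H.Adj w u → τ w < τ u → w ∉ M)
    (hmax : ∀ u, u ≠ v → ¬ H.Adj v u → (∀ w, H.Adj w u → τ w < τ u → w ∉ M) → u ∈ M) :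
    IsPartialEval H τ v (M \ Sunion H M (pushFirst τ v) v) (Sunion H M (pushFirst τ v) v) := by
  have root : v ∈ Sunion H M (pushFirst τ v) v := by
    refine Set.mem_iUnion.2 ⟨0, ?_⟩
    rw [Slayer]
    rfl
  have hS := fun u (hu : u ≠ v) =>
    mem_Sunion_iff (H := H) (M := M) (π := pushFirst τ v) hu
  generalize Sunion H M (pushFirst τ v) v = S at root hS ⊢
  have hS' : ∀ u, u ≠ v → (u ∈ S ↔
      (u ∈ M ∧ ∃ w, (H.Adj w u ∧ (w = v ∨ τ w < τ u)) ∧ w ∈ S) ∨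
      (u ∉ M ∧ ∀ w, (H.Adj w u ∧ (w = v ∨ τ w < τ u)) → w ∈ M → w ∈ S)) := by
    intro u hu
    have := hS u hu
    simp only [mem_Iset_pushFirst hu] at this
    exact this
  refine ⟨root, fun u hu => hu.2, fun u hu => ?_, fun u hu => ?_⟩
  · have h1 := hS' u hu
    have h2 := hind u hu
    have h3 := hmax u hu
    simp only [Set.mem_sdiff]
    grind
  · have h1 := hS' u hu
    have h2 := hind u hu
    have h3 := hmax u hu
    simp only [Set.mem_sdiff]
    grind

theorem mem_greedySet {G : SimpleGraph V} {π : V → ℕ} {v : V} :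
    v ∈ greedySet G π ↔ ∀ u, G.Adj u v → π u < π v → u ∉ greedySet G π := by
  rw [greedySet, Set.mem_ofPred_eq, greedy]
  rfl

theorem isPartialEval_Spset [Finite V] {c : ChangeData V} (hc : IsTopoChange c) {τ : V → ℕ}
    (hτ : τ c.vss ≤ τ c.vs) :
    IsPartialEval c.HSp τ c.vs (c.M τ \ Spset c τ) (Spset c τ) := by
  apply isPartialEval_Sunion
  · rcases hc with ⟨-, -, -, -, hH, hM, -⟩ | ⟨-, -, hG, -, hH, hM, -⟩ | ⟨-, -, -, hH, hM, -⟩ |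
      ⟨-, hG, -, hH, hM, -⟩
    all_goals
      intro u huv hu w hwv hwu hlt hwM
      rw [hM] at hu hwM
      rw [hH] at hwu
    · exact mem_greedySet.1 hu w hwu hlt hwM
    · exact mem_greedySet.1 hu w ((hG w u).1 hwu).1 hlt hwM
    · exact mem_greedySet.1 hu w hwu hlt hwM
    · exact mem_greedySet.1 hu.1 w ((hG w u).2 ⟨hwu, hwv, huv⟩) hlt hwM.1
  · rcases hc with ⟨-, -, -, -, hH, hM, -⟩ | ⟨-, -, hG, -, hH, hM, -⟩ | ⟨-, -, -, hH, hM, -⟩ |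
      ⟨-, hG, -, hH, hM, -⟩
    all_goals
      intro u huv hvu hall
      rw [hM] at hall ⊢
      rw [hH] at hall hvu
    · exact mem_greedySet.2 hall
    · refine mem_greedySet.2 fun w hwu hlt => hall w ((hG w u).2 ⟨hwu, ?_⟩) hlt
      rintro (⟨rfl, rfl⟩ | ⟨-, rfl⟩)
      · omega
      · exact huv rfl
    · exact mem_greedySet.2 hall
    · refine ⟨mem_greedySet.2 fun w hwu hlt hw => ?_, huv⟩
      obtain ⟨hwu', hwv, -⟩ := (hG w u).1 hwu
      exact hall w hwu' hlt ⟨hw, hwv⟩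

/-- `S'` does not depend on how its vertices are interleaved with the others, nor on the position
of `v*`. -/
theorem Spset_reorder [Finite V] {c : ChangeData V} (hc : IsTopoChange c) {τ σ : V → ℕ}
    (hinj : Function.Injective τ) (hτ : τ c.vss ≤ τ c.vs) (hσ : σ c.vss ≤ σ c.vs)
    (hout : sameOrderOn τ σ (Spset c τ)ᶜ) (hin : sameOrderOn τ σ (Spset c τ \ {c.vs})) :
    Spset c σ = Spset c τ :=
  (isPartialEval_Spset hc hσ).unique ((isPartialEval_Spset hc hτ).reorder hinj hout hin)

section Counting

variable {n : ℕ}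

/-- Under the order `τ`, `p` is the immediate successor of `v` among the elements of `P`. -/
def IsNextIn (P : Finset V) (v : V) (τ : V ≃ Fin n) (p : V) : Prop :=
  p ∈ P ∧ τ v < τ p ∧ ∀ q ∈ P, τ q < τ p → τ q ≤ τ v

/-- The number of elements of `P` that precede `v`. -/
def rankIn (P : Finset V) (v : V) (τ : V ≃ Fin n) : ℕ :=
  (P.filter fun q => τ q < τ v).card

variable {P : Finset V} {v p : V} {τ : V ≃ Fin n}

theorem exists_isNextIn (h : ∃ q ∈ P, τ v < τ q) : ∃ p, IsNextIn P v τ p := by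
  obtain ⟨q, hq, hlt⟩ := h
  obtain ⟨p, hp, hmin⟩ := (P.filter fun q => τ v < τ q).exists_min_image τ ⟨q, by simp [hq, hlt]⟩
  rw [Finset.mem_filter] at hp
  refine ⟨p, hp.1, hp.2, fun r hr hrp => ?_⟩
  by_contra! hvr
  exact absurd (hmin r (by simp [hr, hvr])) (not_le.2 hrp)

theorem IsNextIn.unique {p' : V} (h : IsNextIn P v τ p) (h' : IsNextIn P v τ p') : p = p' := by
  apply τ.injective
  apply le_antisymm
  · by_contra! hlt
    exact absurd (h.2.2 p' h'.1 hlt) (not_le.2 h'.2.1)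
  · by_contra! hlt
    exact absurd (h'.2.2 p h.1 hlt) (not_le.2 h.2.1)

theorem IsNextIn.ne (h : IsNextIn P v τ p) : p ≠ v := by
  rintro rfl
  exact lt_irrefl _ h.2.1

theorem IsNextIn.lt_iff {q : V} (h : IsNextIn P v τ p) (hq : q ∈ P) (hqv : q ≠ v) :
    τ q < τ p ↔ τ q < τ v :=
  ⟨fun hlt => lt_of_le_of_ne (h.2.2 q hq hlt) (fun e => hqv (τ.injective e)),
    fun hlt => hlt.trans h.2.1⟩

theorem rankIn_lt (hv : v ∈ P) : rankIn P v τ < P.card :=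
  Finset.card_lt_card (Finset.filter_ssubset.2 ⟨v, hv, lt_irrefl _⟩)

variable [DecidableEq V]

theorem swap_trans_left : (Equiv.swap v p).trans τ v = τ p := by simp

theorem swap_trans_right : (Equiv.swap v p).trans τ p = τ v := by simp

theorem swap_trans_of_ne {q : V} (hv : q ≠ v) (hp : q ≠ p) :
    (Equiv.swap v p).trans τ q = τ q := by
  simp [Equiv.swap_apply_of_ne_of_ne hv hp]

theorem exists_isNextIn_swap (h : ∃ q ∈ P, τ q < τ v) :
    ∃ p, IsNextIn P v ((Equiv.swap v p).trans τ) p := by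
  obtain ⟨q, hq, hlt⟩ := h
  obtain ⟨p, hp, hmax⟩ := (P.filter fun q => τ q < τ v).exists_max_image τ ⟨q, by simp [hq, hlt]⟩
  rw [Finset.mem_filter] at hp
  refine ⟨p, hp.1, ?_, fun r hr hrp => ?_⟩
  · rw [swap_trans_left, swap_trans_right]
    exact hp.2
  · rw [swap_trans_right] at hrp
    rw [swap_trans_left]
    by_cases hrv : r = v
    · rw [hrv, swap_trans_left]
    by_cases hrp' : r = p
    · rw [hrp', swap_trans_right] at hrp
      exact absurd hrp (lt_irrefl _)
    rw [swap_trans_of_ne hrv hrp'] at hrp ⊢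
    exact hmax r (by simp [hr, hrp])

theorem IsNextIn.rankIn_swap (hv : v ∈ P) (h : IsNextIn P v τ p) :
    rankIn P v ((Equiv.swap v p).trans τ) = rankIn P v τ + 1 := by
  have hp : p ∉ P.filter fun q => τ q < τ v := by
    simp [h.2.1.le]
  rw [rankIn, rankIn, ← Finset.card_insert_of_notMem hp]
  congr 1
  ext q
  simp only [Finset.mem_filter, Finset.mem_insert, swap_trans_left]
  by_cases hqp : q = p
  · subst hqp
    simp only [swap_trans_right, h.1, h.2.1, true_and, true_or]
  by_cases hqv : q = v
  · subst hqv
    simp only [swap_trans_left, lt_irrefl, and_false, Ne.symm h.ne, or_self]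
  rw [swap_trans_of_ne hqv hqp]
  simp only [hqp, false_or, and_congr_right_iff]
  exact fun hq => h.lt_iff hq hqv

theorem IsNextIn.eq_of_swap_eq {p' : V} {τ' : V ≃ Fin n} (h : IsNextIn P v τ p)
    (h' : IsNextIn P v τ' p') (e : (Equiv.swap v p).trans τ = (Equiv.swap v p').trans τ') :
    τ = τ' := by
  have hpp : p = p' := by
    by_contra hne
    have h1 : τ p = τ' p' := by
      rw [← swap_trans_left (v := v) (τ := τ), e, swap_trans_left]
    have h2 : τ v = τ' p := by
      rw [← swap_trans_right (p := p) (τ := τ), e, swap_trans_of_ne h.ne hne]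
    have h3 : τ p' = τ' v := by
      rw [← swap_trans_right (p := p') (τ := τ'), ← e, swap_trans_of_ne h'.ne (Ne.symm hne)]
    have h4 := (h'.lt_iff h.1 h.ne).1 (by rw [← h2, ← h1]; exact h.2.1)
    have h5 := (h.lt_iff h'.1 h'.ne).1 (by rw [h3, h1]; exact h'.2.1)
    rw [← h2, ← h3] at h4
    exact lt_asymm h4 h5
  subst hpp
  ext q
  have := congrArg (fun f => f (Equiv.swap v p q)) e
  simpa using congrArg Fin.val this

variable [Fintype V] {Good : (V ≃ Fin n) → Prop}

theorem card_rank_le_succ (hv : v ∈ P)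
    (hup : ∀ τ p, IsNextIn P v τ p → Good τ → Good ((Equiv.swap v p).trans τ))
    {j : ℕ} (hj : j + 1 < P.card) :
    (Finset.univ.filter fun τ => Good τ ∧ rankIn P v τ = j).card ≤
      (Finset.univ.filter fun τ => Good τ ∧ rankIn P v τ = j + 1).card := by
  refine Finset.card_le_card_of_forall_subsingleton
    (fun τ σ => ∃ p, IsNextIn P v τ p ∧ σ = (Equiv.swap v p).trans τ) ?_ ?_
  · intro τ hτ
    rw [Finset.mem_filter] at hτ
    obtain ⟨-, hg, hr⟩ := hτ
    have : ∃ q ∈ P, τ v < τ q := by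
      by_contra! hall
      have hsub : P.erase v ⊆ P.filter fun q => τ q < τ v := by
        intro q hq
        rw [Finset.mem_erase] at hq
        exact Finset.mem_filter.2
          ⟨hq.2, lt_of_le_of_ne (hall q hq.2) fun e => hq.1 (τ.injective e)⟩
      have := Finset.card_le_card hsub
      rw [Finset.card_erase_of_mem hv] at this
      unfold rankIn at hr
      omega
    obtain ⟨p, hp⟩ := exists_isNextIn this
    refine ⟨_, Finset.mem_filter.2 ⟨Finset.mem_univ _, hup τ p hp hg, ?_⟩, p, hp, rfl⟩
    rw [hp.rankIn_swap hv, hr]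
  · rintro σ - τ ⟨-, p, hp, e⟩ τ' ⟨-, p', hp', e'⟩
    exact hp.eq_of_swap_eq hp' (e.symm.trans e')

theorem card_rank_succ_le (hv : v ∈ P)
    (hdown : ∀ τ p, IsNextIn P v τ p → Good ((Equiv.swap v p).trans τ) → Good τ) (j : ℕ) :
    (Finset.univ.filter fun τ => Good τ ∧ rankIn P v τ = j + 1).card ≤
      (Finset.univ.filter fun τ => Good τ ∧ rankIn P v τ = j).card := by
  have swap_swap (p : V) (σ : V ≃ Fin n) :
      (Equiv.swap v p).trans ((Equiv.swap v p).trans σ) = σ := by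
    ext q
    simp
  refine Finset.card_le_card_of_forall_subsingleton
    (fun σ τ => ∃ p, IsNextIn P v τ p ∧ σ = (Equiv.swap v p).trans τ) ?_ ?_
  · intro σ hσ
    rw [Finset.mem_filter] at hσ
    obtain ⟨-, hg, hr⟩ := hσ
    have hne : (P.filter fun q => σ q < σ v).Nonempty := by
      rw [← Finset.card_pos]
      unfold rankIn at hr
      omega
    obtain ⟨q, hq⟩ := hne
    obtain ⟨p, hp⟩ := exists_isNextIn_swap ⟨q, Finset.mem_filter.1 hq⟩
    have hrank := hp.rankIn_swap hv
    rw [swap_swap, hr] at hrank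
    refine ⟨_, Finset.mem_filter.2 ⟨Finset.mem_univ _, hdown _ p hp ?_, by omega⟩, p, hp, ?_⟩
    · rwa [swap_swap]
    · rw [swap_swap]
  · rintro τ - σ ⟨-, p, hp, e⟩ σ' ⟨-, p', hp', e'⟩
    rw [e, e', hp.unique hp']

theorem card_good_eq_sum (hv : v ∈ P) :
    (Finset.univ.filter Good).card = ∑ j ∈ Finset.range P.card,
      (Finset.univ.filter fun τ => Good τ ∧ rankIn P v τ = j).card := by
  rw [Finset.card_eq_sum_card_fiberwise (f := rankIn P v) (t := Finset.range P.card)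
    (fun τ _ => by simpa using rankIn_lt hv)]
  simp only [Finset.filter_filter]

theorem card_mul_card_first_le (hv : v ∈ P)
    (hup : ∀ τ p, IsNextIn P v τ p → Good τ → Good ((Equiv.swap v p).trans τ)) :
    P.card * (Finset.univ.filter fun τ => Good τ ∧ rankIn P v τ = 0).card ≤
      (Finset.univ.filter Good).card := by
  have hle : ∀ j < P.card, (Finset.univ.filter fun τ => Good τ ∧ rankIn P v τ = 0).card ≤
      (Finset.univ.filter fun τ => Good τ ∧ rankIn P v τ = j).card := by
    intro j
    induction j with
    | zero => exact fun _ => le_rfl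
    | succ j ih => exact fun hj => (ih (by omega)).trans (card_rank_le_succ hv hup hj)
  rw [card_good_eq_sum hv]
  simpa using Finset.card_nsmul_le_sum (Finset.range P.card) _ _
    fun j hj => hle j (Finset.mem_range.1 hj)

theorem card_good_le (hv : v ∈ P)
    (hdown : ∀ τ p, IsNextIn P v τ p → Good ((Equiv.swap v p).trans τ) → Good τ) :
    (Finset.univ.filter Good).card ≤
      P.card * (Finset.univ.filter fun τ => Good τ ∧ rankIn P v τ = 0).card := by
  have hle : ∀ j, (Finset.univ.filter fun τ => Good τ ∧ rankIn P v τ = j).card ≤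
      (Finset.univ.filter fun τ => Good τ ∧ rankIn P v τ = 0).card := by
    intro j
    induction j with
    | zero => exact le_rfl
    | succ j ih => exact (card_rank_succ_le hv hdown j).trans ih
  rw [card_good_eq_sum hv]
  simpa using Finset.sum_le_card_nsmul (Finset.range P.card) _ _ fun j _ => hle j

end Counting

theorem IsNextIn.sameOrderOn_swap [Fintype V] [DecidableEq V] {P : Finset V} {v p : V}
    {τ : V ≃ Fin (Fintype.card V)} (hv : v ∈ P) (h : IsNextIn P v τ p) :
    sameOrderOn (toOrd τ) (toOrd ((Equiv.swap v p).trans τ)) (P : Set V)ᶜ ∧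
      sameOrderOn (toOrd τ) (toOrd ((Equiv.swap v p).trans τ)) ((P : Set V) \ {v}) := by
  constructor
  · intro x hx y hy
    have ne : ∀ z ∈ (P : Set V)ᶜ, (Equiv.swap v p).trans τ z = τ z := fun z hz =>
      swap_trans_of_ne (fun e => hz (e ▸ hv)) (fun e => hz (e ▸ h.1))
    rw [toOrd, toOrd, toOrd, toOrd, ne x hx, ne y hy]
  · rintro x ⟨hx, hxv⟩ y ⟨hy, hyv⟩
    simp only [Set.mem_singleton_iff] at hxv hyv
    simp only [toOrd, Fin.val_fin_lt]
    by_cases hxp : x = p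
    · by_cases hyp : y = p
      · simp [hxp, hyp]
      · rw [hxp, swap_trans_right, swap_trans_of_ne hyv hyp]
        have := h.lt_iff hy hyv
        have h1 : τ y ≠ τ p := fun e => hyp (τ.injective e)
        have h2 : τ y ≠ τ v := fun e => hyv (τ.injective e)
        constructor
        · intro hlt
          exact lt_of_le_of_ne (not_lt.1 fun hc => lt_asymm hlt (this.2 hc)) h2.symm
        · intro hlt
          exact lt_of_le_of_ne (not_lt.1 fun hc => lt_asymm hlt (this.1 hc)) h1.symm
    · by_cases hyp : y = p
      · rw [hyp, swap_trans_right, swap_trans_of_ne hxv hxp]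
        exact h.lt_iff hx hxv
      · rw [swap_trans_of_ne hxv hxp, swap_trans_of_ne hyv hyp]

/-- Conditioned on `S'(π) = P` and `π(v**) ≤ π(v*)`, the probability that `π(v*)` is
minimal in `P` is at most `1/|P|`, with equality for a node change. -/
theorem stmt10 {V : Type*} [Fintype V] [DecidableEq V] (c : ChangeData V)
    (hc : IsTopoChange c) (P : Set V)
    (hpos : ∃ π : V ≃ Fin (Fintype.card V),
      Spset c (toOrd π) = P ∧ toOrd π c.vss ≤ toOrd π c.vs) :
    (((Finset.univ.filter (fun π : V ≃ Fin (Fintype.card V) =>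
          Spset c (toOrd π) = P ∧ toOrd π c.vss ≤ toOrd π c.vs ∧
          ∀ u ∈ P, toOrd π c.vs ≤ toOrd π u)).card : ℝ)
      / ((Finset.univ.filter (fun π : V ≃ Fin (Fintype.card V) =>
          Spset c (toOrd π) = P ∧ toOrd π c.vss ≤ toOrd π c.vs)).card : ℝ)
      ≤ 1 / (P.ncard : ℝ)) ∧
    ((IsNodeDel c ∨ IsNodeIns c) →
      ((Finset.univ.filter (fun π : V ≃ Fin (Fintype.card V) =>
          Spset c (toOrd π) = P ∧ toOrd π c.vss ≤ toOrd π c.vs ∧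
          ∀ u ∈ P, toOrd π c.vs ≤ toOrd π u)).card : ℝ)
      / ((Finset.univ.filter (fun π : V ≃ Fin (Fintype.card V) =>
          Spset c (toOrd π) = P ∧ toOrd π c.vss ≤ toOrd π c.vs)).card : ℝ)
      = 1 / (P.ncard : ℝ)) := by
  have root : ∀ τ : V → ℕ, c.vs ∈ Spset c τ := fun τ => by
    refine Set.mem_iUnion.2 ⟨0, ?_⟩
    rw [Slayer]
    rfl
  obtain ⟨π₀, hπ₀, hle₀⟩ := hpos
  have hvP : c.vs ∈ P := hπ₀ ▸ root _
  obtain ⟨Q, rfl⟩ := P.toFinite.exists_finset_coe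
  have hv : c.vs ∈ Q := hvP
  have hinj : ∀ τ : V ≃ Fin (Fintype.card V), Function.Injective (toOrd τ) :=
    fun τ => Fin.val_injective.comp τ.injective
  set Good : (V ≃ Fin (Fintype.card V)) → Prop :=
    fun π => Spset c (toOrd π) = Q ∧ toOrd π c.vss ≤ toOrd π c.vs with hGood
  have hfirst : ∀ _ : DecidablePred fun π : V ≃ Fin (Fintype.card V) =>
      Spset c (toOrd π) = Q ∧ toOrd π c.vss ≤ toOrd π c.vs ∧
        ∀ u ∈ (Q : Set V), toOrd π c.vs ≤ toOrd π u, (Finset.univ.filter (fun π : V ≃ Fin (Fintype.card V) =>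
      Spset c (toOrd π) = Q ∧ toOrd π c.vss ≤ toOrd π c.vs ∧
        ∀ u ∈ (Q : Set V), toOrd π c.vs ≤ toOrd π u)) =
      Finset.univ.filter fun τ => Good τ ∧ rankIn Q c.vs τ = 0 := by
    intro _
    ext π
    simp [hGood, rankIn, toOrd, and_assoc, Finset.filter_eq_empty_iff]
  have swap_iff : ∀ τ p, IsNextIn Q c.vs τ p → toOrd τ c.vss ≤ toOrd τ c.vs →
      toOrd ((Equiv.swap c.vs p).trans τ) c.vss ≤ toOrd ((Equiv.swap c.vs p).trans τ) c.vs →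
      (Spset c (toOrd τ) = Q ↔ Spset c (toOrd ((Equiv.swap c.vs p).trans τ)) = Q) := by
    intro τ p hp h1 h2
    obtain ⟨hout, hin⟩ := hp.sameOrderOn_swap hv
    constructor
    · intro e
      rw [← e] at hout hin ⊢
      exact Spset_reorder hc (hinj _) h1 h2 hout hin
    · intro e
      rw [← e] at hout hin ⊢
      exact Spset_reorder hc (hinj _) h2 h1 (fun x hx y hy => (hout x hx y hy).symm)
        (fun x hx y hy => (hin x hx y hy).symm)
  have hQ : (0 : ℝ) < Q.card := by exact_mod_cast Finset.card_pos.2 ⟨_, hv⟩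
  have hpos : (0 : ℝ) < (Finset.univ.filter Good).card :=
    Nat.cast_pos.2 (Finset.card_pos.2
      ⟨π₀, Finset.mem_filter.2 ⟨Finset.mem_univ _, hπ₀, hle₀⟩⟩)
  rw [hfirst, Set.ncard_coe_finset]
  constructor
  · rw [div_le_div_iff₀ hpos hQ, one_mul, mul_comm]
    by_cases hmem : c.vss ≠ c.vs ∧ c.vss ∈ Q
    · have hempty : (Finset.univ.filter fun τ => Good τ ∧ rankIn Q c.vs τ = 0) = ∅ := by
        refine Finset.filter_eq_empty_iff.2 fun τ _ hτ => ?_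
        obtain ⟨⟨-, hle⟩, hr⟩ := hτ
        rw [rankIn, Finset.card_eq_zero, Finset.filter_eq_empty_iff] at hr
        exact hr hmem.2 (lt_of_le_of_ne hle fun e => hmem.1 (τ.injective e))
      rw [hempty]
      simp
    · have := card_mul_card_first_le (Good := Good) hv fun τ p hp hg => by
        have h2 : toOrd ((Equiv.swap c.vs p).trans τ) c.vss ≤
            toOrd ((Equiv.swap c.vs p).trans τ) c.vs := by
          by_cases he : c.vss = c.vs
          · rw [he]
          have hvss : c.vss ∉ Q := fun h => hmem ⟨he, h⟩
          rw [toOrd, toOrd, swap_trans_left, swap_trans_of_ne he fun e => hvss (e ▸ hp.1)]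
          exact hg.2.trans hp.2.1.le
        exact ⟨(swap_iff τ p hp hg.2 h2).1 hg.1, h2⟩
      norm_cast
      convert this
  · intro hnode
    have he : c.vss = c.vs := hnode.elim (fun h => h.1) (fun h => h.1)
    have hle : ∀ τ : V ≃ Fin (Fintype.card V), toOrd τ c.vss ≤ toOrd τ c.vs :=
      fun τ => by rw [he]
    have h1 := card_mul_card_first_le (Good := Good) hv fun τ p hp hg =>
      ⟨(swap_iff τ p hp (hle _) (hle _)).1 hg.1, hle _⟩
    have h2 := card_good_le (Good := Good) hv fun τ p hp hg =>
      ⟨(swap_iff τ p hp (hle _) (hle _)).2 hg.1, hle _⟩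
    rw [div_eq_div_iff hpos.ne' hQ.ne', one_mul, mul_comm]
    norm_cast
    convert le_antisymm h1 h2

end
end
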